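/- arXiv:2101.11150 — 2 statements merged into one kernel-verified Lean document; each statement's English description precedes it below -/
import Mathlib

section
/- (Avalanche principle, matrix chain bound.) Let A₁,…,A_n ∈ SL(2,ℝ) satisfy min_j ‖A_j‖ ≥ μ > n and max_{1≤j≤n-1} |ln‖A_j‖ + ln‖A_{j+1}‖ − ln‖A_{j+1}A_j‖| < (1/2)·ln μ. Then there is an absolute constant C such that |ln‖A_n⋯A₁‖ + ∑_{j=2}^{n-1} ln‖A_j‖ − ∑_{j=1}^{n-1} ln‖A_{j+1}A_j‖| < C·n/μ. -/
/-- The (Euclidean) operator norm of a `2 × 2` real matrix. -/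
noncomputable def opNormR (A : Matrix (Fin 2) (Fin 2) ℝ) : ℝ :=
  ‖LinearMap.toContinuousLinearMap (Matrix.toEuclideanLin A)‖

/-- The continuous linear map on the Euclidean plane given by a `2 × 2` real matrix. -/
noncomputable def matrixCLM (A : Matrix (Fin 2) (Fin 2) ℝ) :
    EuclideanSpace ℝ (Fin 2) →L[ℝ] EuclideanSpace ℝ (Fin 2) :=
  LinearMap.toContinuousLinearMap (Matrix.toEuclideanLin A)

lemma matrixCLM_mul_apply (A B : Matrix (Fin 2) (Fin 2) ℝ) (x : EuclideanSpace ℝ (Fin 2)) :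
    matrixCLM (A * B) x = matrixCLM A (matrixCLM B x) := by
  simp [matrixCLM, Matrix.toLpLin_apply]

lemma norm_sq_matrixCLM (A : Matrix (Fin 2) (Fin 2) ℝ) (x : EuclideanSpace ℝ (Fin 2)) :
    ‖matrixCLM A x‖ ^ 2 = (A 0 0 * x 0 + A 0 1 * x 1) ^ 2 + (A 1 0 * x 0 + A 1 1 * x 1) ^ 2 := by
  simp [matrixCLM, EuclideanSpace.norm_sq_eq, Matrix.toLpLin_apply,
    Fin.sum_univ_two]

lemma norm_sq_plane (x : EuclideanSpace ℝ (Fin 2)) : ‖x‖ ^ 2 = x 0 ^ 2 + x 1 ^ 2 := by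
  simp [EuclideanSpace.norm_sq_eq, Fin.sum_univ_two]

lemma opNormR_nonneg (A : Matrix (Fin 2) (Fin 2) ℝ) : 0 ≤ opNormR A := norm_nonneg _

lemma norm_matrixCLM_le (A : Matrix (Fin 2) (Fin 2) ℝ) (x : EuclideanSpace ℝ (Fin 2)) :
    ‖matrixCLM A x‖ ≤ opNormR A * ‖x‖ := (matrixCLM A).le_opNorm x

lemma exists_norm_matrixCLM_eq (A : Matrix (Fin 2) (Fin 2) ℝ) :
    ∃ u : EuclideanSpace ℝ (Fin 2), ‖u‖ = 1 ∧ ‖matrixCLM A u‖ = opNormR A := by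
  have hne : (Metric.sphere (0 : EuclideanSpace ℝ (Fin 2)) 1).Nonempty :=
    (NormedSpace.sphere_nonempty).2 zero_le_one
  obtain ⟨u, hu, hmax⟩ := (isCompact_sphere (0 : EuclideanSpace ℝ (Fin 2)) 1).exists_isMaxOn hne
    (f := fun x => ‖matrixCLM A x‖) (by fun_prop)
  have hu1 : ‖u‖ = 1 := by simpa using hu
  refine ⟨u, hu1, le_antisymm (by simpa [hu1] using norm_matrixCLM_le A u) ?_⟩
  exact ContinuousLinearMap.opNorm_le_of_unit_norm (norm_nonneg _)
    fun x hx => hmax (by simpa using hx)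

lemma opNormR_pos {A : Matrix (Fin 2) (Fin 2) ℝ} (hA : A.det = 1) : 0 < opNormR A := by
  refine (opNormR_nonneg A).lt_of_ne' fun h => ?_
  have h0 : ∀ x, ‖matrixCLM A x‖ = 0 := fun x =>
    le_antisymm (by simpa [h] using norm_matrixCLM_le A x) (norm_nonneg _)
  have h1 := norm_sq_matrixCLM A !₂[1, 0]
  have h2 := norm_sq_matrixCLM A !₂[0, 1]
  rw [h0] at h1 h2
  simp at h1 h2
  rw [Matrix.det_fin_two] at hA
  nlinarith [sq_nonneg (A 0 0), sq_nonneg (A 1 0), sq_nonneg (A 1 1), sq_nonneg (A 0 1),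
    sq_nonneg (A 0 0 - A 1 1), sq_nonneg (A 0 1 + A 1 0)]

/-- Singular value decomposition of a matrix in `SL(2, ℝ)`. -/
lemma exists_singular_basis {Y : Matrix (Fin 2) (Fin 2) ℝ} (hY : Y.det = 1) :
    ∃ u w : EuclideanSpace ℝ (Fin 2), ‖u‖ = 1 ∧ ‖matrixCLM Y w‖ = (opNormR Y)⁻¹ ∧
      ∀ x, ∃ a b : ℝ, x = a • u + b • w ∧ a ^ 2 + b ^ 2 = ‖x‖ ^ 2 ∧
        ‖matrixCLM Y x‖ ^ 2 = a ^ 2 * opNormR Y ^ 2 + b ^ 2 * (opNormR Y)⁻¹ ^ 2 := by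
  obtain ⟨u, hu, hYu⟩ := exists_norm_matrixCLM_eq Y
  have hpos := opNormR_pos hY
  have hbd : ∀ x : EuclideanSpace ℝ (Fin 2),
      (Y 0 0 * x 0 + Y 0 1 * x 1) ^ 2 + (Y 1 0 * x 0 + Y 1 1 * x 1) ^ 2 ≤
        opNormR Y ^ 2 * (x 0 ^ 2 + x 1 ^ 2) := fun x => by
    rw [← norm_sq_matrixCLM, ← norm_sq_plane, ← mul_pow]
    exact pow_le_pow_left₀ (norm_nonneg _) (norm_matrixCLM_le Y x) 2
  set l := opNormR Y
  have hu2 : u 0 ^ 2 + u 1 ^ 2 = 1 := by rw [← norm_sq_plane, hu, one_pow]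
  have hYu2 : (Y 0 0 * u 0 + Y 0 1 * u 1) ^ 2 + (Y 1 0 * u 0 + Y 1 1 * u 1) ^ 2 = l ^ 2 := by
    rw [← norm_sq_matrixCLM, hYu]
  have hw2 := norm_sq_matrixCLM Y !₂[-u 1, u 0]
  have hvar : ∀ t : ℝ, _ := fun t => hbd !₂[u 0 - t * u 1, u 1 + t * u 0]
  simp only [Matrix.cons_val_zero, Matrix.cons_val_one] at hw2 hvar
  rw [Matrix.det_fin_two] at hY
  set p := Y 0 0 * u 0 + Y 0 1 * u 1 with hp
  set q := Y 1 0 * u 0 + Y 1 1 * u 1 with hq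
  set r := Y 0 0 * -u 1 + Y 0 1 * u 0 with hr
  set s := Y 1 0 * -u 1 + Y 1 1 * u 0 with hs
  have hdet : p * s - q * r = 1 := by
    rw [hp, hq, hr, hs]
    linear_combination (u 0 ^ 2 + u 1 ^ 2) * hY + hu2
  have hvar' : ∀ t : ℝ, 2 * t * (p * r + q * s) ≤ t ^ 2 * l ^ 2 := fun t => by
    have h := hvar t
    have e1 : Y 0 0 * (u 0 - t * u 1) + Y 0 1 * (u 1 + t * u 0) = p + t * r := by
      rw [hp, hr]; ring
    have e2 : Y 1 0 * (u 0 - t * u 1) + Y 1 1 * (u 1 + t * u 0) = q + t * s := by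
      rw [hq, hs]; ring
    have e3 : (u 0 - t * u 1) ^ 2 + (u 1 + t * u 0) ^ 2 = 1 + t ^ 2 := by
      linear_combination (1 + t ^ 2) * hu2
    rw [e1, e2, e3] at h
    nlinarith [sq_nonneg (t * r), sq_nonneg (t * s)]
  have horth : p * r + q * s = 0 := by
    have h := hvar' ((p * r + q * s) / l ^ 2)
    have e : 2 * ((p * r + q * s) / l ^ 2) * (p * r + q * s)
        - ((p * r + q * s) / l ^ 2) ^ 2 * l ^ 2 = (p * r + q * s) ^ 2 / l ^ 2 := by
      field_simp; ring
    have h3 : (p * r + q * s) ^ 2 / l ^ 2 ≤ 0 := by linarith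
    have h4 : (p * r + q * s) ^ 2 ≤ 0 := by
      rw [div_le_iff₀ (by positivity)] at h3; simpa using h3
    exact pow_eq_zero_iff (two_ne_zero) |>.1 (le_antisymm h4 (sq_nonneg _))
  have hprod : l ^ 2 * (r ^ 2 + s ^ 2) = 1 := by
    rw [← hYu2]
    linear_combination (p * r + q * s) * horth + (p * s - q * r + 1) * hdet
  have hrs : r ^ 2 + s ^ 2 = l⁻¹ ^ 2 := by
    field_simp; linarith
  refine ⟨u, !₂[-u 1, u 0], hu, ?_, fun x => ⟨x 0 * u 0 + x 1 * u 1, x 1 * u 0 - x 0 * u 1,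
    ?_, ?_, ?_⟩⟩
  · exact (pow_left_inj₀ (norm_nonneg _) (by positivity) two_ne_zero).1 (hw2.trans hrs)
  · ext i
    fin_cases i
    · simp; linear_combination (-x 0) * hu2
    · simp; linear_combination (-x 1) * hu2
  · rw [norm_sq_plane]
    linear_combination (x 0 ^ 2 + x 1 ^ 2) * hu2
  · rw [norm_sq_matrixCLM, ← hrs, ← hYu2]
    have e1 : Y 0 0 * x 0 + Y 0 1 * x 1
        = (x 0 * u 0 + x 1 * u 1) * p + (x 1 * u 0 - x 0 * u 1) * r := by
      rw [hp, hr]; linear_combination (-(Y 0 0 * x 0 + Y 0 1 * x 1)) * hu2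
    have e2 : Y 1 0 * x 0 + Y 1 1 * x 1
        = (x 0 * u 0 + x 1 * u 1) * q + (x 1 * u 0 - x 0 * u 1) * s := by
      rw [hq, hs]; linear_combination (-(Y 1 0 * x 0 + Y 1 1 * x 1)) * hu2
    rw [e1, e2]
    linear_combination 2 * (x 0 * u 0 + x 1 * u 1) * (x 1 * u 0 - x 0 * u 1) * horth

lemma opNormR_triple_le (X Z : Matrix (Fin 2) (Fin 2) ℝ) {Y : Matrix (Fin 2) (Fin 2) ℝ}
    (hY : Y.det = 1) :
    opNormR Y * opNormR (X * (Y * Z)) ≤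
      opNormR (X * Y) * opNormR (Y * Z) + opNormR X * opNormR Z := by
  obtain ⟨u, w, hu, hw, hdec⟩ := exists_singular_basis hY
  have hpos := opNormR_pos hY
  obtain ⟨y, hy, hm⟩ := exists_norm_matrixCLM_eq (X * (Y * Z))
  obtain ⟨a, b, hx, hab, hYx⟩ := hdec (matrixCLM Z y)
  have hZ := norm_matrixCLM_le Z y
  have hYZ := norm_matrixCLM_le (Y * Z) y
  have hXu := norm_matrixCLM_le (X * Y) u
  have hXw := norm_matrixCLM_le X (matrixCLM Y w)
  rw [hw] at hXw
  rw [hy, mul_one] at hZ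
  rw [hy, mul_one, matrixCLM_mul_apply] at hYZ
  rw [hu, mul_one, matrixCLM_mul_apply] at hXu
  have hb : |b| ≤ opNormR Z :=
    (abs_le_of_sq_le_sq (by nlinarith) (norm_nonneg _)).trans hZ
  have ha : opNormR Y * |a| ≤ opNormR (Y * Z) := by
    refine le_trans ?_ hYZ
    refine le_of_sq_le_sq ?_ (norm_nonneg _)
    rw [hYx, mul_pow, sq_abs]
    nlinarith [mul_nonneg (sq_nonneg b) (sq_nonneg (opNormR Y)⁻¹)]
  rw [matrixCLM_mul_apply, matrixCLM_mul_apply, hx] at hm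
  simp only [map_add, map_smul] at hm
  have htri := norm_add_le (a • matrixCLM X (matrixCLM Y u)) (b • matrixCLM X (matrixCLM Y w))
  rw [hm, norm_smul, norm_smul, Real.norm_eq_abs, Real.norm_eq_abs] at htri
  calc opNormR Y * opNormR (X * (Y * Z))
      ≤ opNormR Y * (|a| * opNormR (X * Y) + opNormR Z * (opNormR X * (opNormR Y)⁻¹)) := by
        refine mul_le_mul_of_nonneg_left (htri.trans ?_) hpos.le
        have := opNormR_nonneg Z
        gcongr
    _ = (opNormR Y * |a|) * opNormR (X * Y) + opNormR X * opNormR Z := by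
        field_simp
    _ ≤ opNormR (Y * Z) * opNormR (X * Y) + opNormR X * opNormR Z := by
        have := opNormR_nonneg (X * Y)
        gcongr
    _ = _ := by ring

lemma le_opNormR_triple (X Z : Matrix (Fin 2) (Fin 2) ℝ) {Y : Matrix (Fin 2) (Fin 2) ℝ}
    (hY : Y.det = 1) {ε : ℝ} (hε : ε ≤ 1)
    (hX : (opNormR X * (opNormR Y)⁻¹) ^ 2 ≤ ε * opNormR (X * Y) ^ 2)
    (hZ : (opNormR Z * (opNormR Y)⁻¹) ^ 2 ≤ ε * opNormR (Y * Z) ^ 2) :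
    (1 - ε) * (opNormR (X * Y) * opNormR (Y * Z)) ≤
      opNormR Y * opNormR (X * (Y * Z)) + opNormR X * opNormR Z := by
  obtain ⟨u, w, hu, hw, hdec⟩ := exists_singular_basis hY
  have hpos := opNormR_pos hY
  have hXw := norm_matrixCLM_le X (matrixCLM Y w)
  rw [hw] at hXw
  -- the image of the expanding direction of `Y` almost realizes the norm of `X * Y`
  have hP : (1 - ε) * opNormR (X * Y) ^ 2 ≤ ‖matrixCLM X (matrixCLM Y u)‖ ^ 2 := by
    obtain ⟨y, hy, hp⟩ := exists_norm_matrixCLM_eq (X * Y)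
    obtain ⟨a, b, hx, hab, -⟩ := hdec y
    rw [matrixCLM_mul_apply, hx] at hp
    simp only [map_add, map_smul] at hp
    have htri := norm_add_le (a • matrixCLM X (matrixCLM Y u)) (b • matrixCLM X (matrixCLM Y w))
    rw [hp, norm_smul, norm_smul, Real.norm_eq_abs, Real.norm_eq_abs] at htri
    have hab1 : |a| ^ 2 + |b| ^ 2 = 1 := by rw [sq_abs, sq_abs, hab, hy, one_pow]
    have hle : opNormR (X * Y) ≤
        |a| * ‖matrixCLM X (matrixCLM Y u)‖ + |b| * (opNormR X * (opNormR Y)⁻¹) :=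
      htri.trans (by gcongr)
    have hsq := pow_le_pow_left₀ (opNormR_nonneg (X * Y)) hle 2
    generalize ‖matrixCLM X (matrixCLM Y u)‖ = P at *
    generalize opNormR X * (opNormR Y)⁻¹ = e at *
    have hcs : (|a| * P + |b| * e) ^ 2 ≤ (|a| ^ 2 + |b| ^ 2) * (P ^ 2 + e ^ 2) := by
      nlinarith [sq_nonneg (|a| * e - |b| * P)]
    rw [hab1] at hcs
    linarith
  obtain ⟨y, hy, hq⟩ := exists_norm_matrixCLM_eq (Y * Z)
  obtain ⟨a, b, hx, hab, hYx⟩ := hdec (matrixCLM Z y)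
  have hZy := norm_matrixCLM_le Z y
  have hm := norm_matrixCLM_le (X * (Y * Z)) y
  rw [hy, mul_one] at hZy hm
  have hb : |b| ≤ opNormR Z :=
    (abs_le_of_sq_le_sq (by nlinarith) (norm_nonneg _)).trans hZy
  have hQ : (1 - ε) * opNormR (Y * Z) ^ 2 ≤ (opNormR Y * |a|) ^ 2 := by
    rw [matrixCLM_mul_apply] at hq
    rw [hq] at hYx
    have hb2 : b ^ 2 ≤ opNormR Z ^ 2 := by
      rw [← sq_abs]; exact pow_le_pow_left₀ (abs_nonneg b) hb 2
    have : b ^ 2 * (opNormR Y)⁻¹ ^ 2 ≤ opNormR Z ^ 2 * (opNormR Y)⁻¹ ^ 2 := by gcongr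
    rw [mul_pow, sq_abs]
    rw [mul_pow] at hZ
    linarith
  rw [matrixCLM_mul_apply, matrixCLM_mul_apply, hx] at hm
  simp only [map_add, map_smul] at hm
  have htri := norm_sub_norm_le (a • matrixCLM X (matrixCLM Y u))
    (-(b • matrixCLM X (matrixCLM Y w)))
  rw [sub_neg_eq_add, norm_neg, norm_smul, norm_smul, Real.norm_eq_abs, Real.norm_eq_abs] at htri
  have hbX : |b| * ‖matrixCLM X (matrixCLM Y w)‖ ≤ opNormR Z * (opNormR X * (opNormR Y)⁻¹) := by
    have := opNormR_nonneg Z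
    gcongr
  have hmain : (1 - ε) * (opNormR (X * Y) * opNormR (Y * Z)) ≤
      ‖matrixCLM X (matrixCLM Y u)‖ * (opNormR Y * |a|) := by
    refine le_of_sq_le_sq ?_ (by positivity)
    have hprod := mul_le_mul hP hQ
      (mul_nonneg (sub_nonneg.2 hε) (sq_nonneg _)) (sq_nonneg _)
    linarith
  have hfin : ‖matrixCLM X (matrixCLM Y u)‖ * (opNormR Y * |a|) ≤
      opNormR Y * (opNormR (X * (Y * Z)) + opNormR Z * (opNormR X * (opNormR Y)⁻¹)) := by
    have := mul_le_mul_of_nonneg_left (show |a| * ‖matrixCLM X (matrixCLM Y u)‖ ≤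
      opNormR (X * (Y * Z)) + opNormR Z * (opNormR X * (opNormR Y)⁻¹) by linarith) hpos.le
    linarith
  refine hmain.trans (hfin.trans_eq ?_)
  field_simp

/-- One step of the avalanche principle: extending a chain `Y * Z` by `X` on the left multiplies
the norm by `‖X * Y‖ / ‖Y‖`, up to a relative error of order `1 / (μ * r)`. -/
lemma opNormR_triple_bounds {X Y Z : Matrix (Fin 2) (Fin 2) ℝ} {μ r : ℝ} (hY : Y.det = 1)
    (hμ : 0 < μ) (hr : 0 < r) (hr1 : r ≤ 1) (hμr : 1 ≤ μ * r) (hμY : μ ≤ opNormR Y)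
    (hXY : opNormR X * opNormR Y ≤ opNormR (X * Y) * √μ)
    (hYZ : r * (opNormR Y * opNormR Z) ≤ opNormR (Y * Z) * √μ) :
    (1 - (μ * r)⁻¹ ^ 2 / μ - (μ * r)⁻¹) * (opNormR (X * Y) * opNormR (Y * Z)) ≤
        opNormR Y * opNormR (X * (Y * Z)) ∧
      opNormR Y * opNormR (X * (Y * Z)) ≤
        (1 + (μ * r)⁻¹) * (opNormR (X * Y) * opNormR (Y * Z)) := by
  have h1 := opNormR_triple_le X Z hY
  have h2 := le_opNormR_triple X Z hY (ε := (μ * r)⁻¹ ^ 2 / μ)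
  have hx := opNormR_nonneg X
  have hz := opNormR_nonneg Z
  have hp := opNormR_nonneg (X * Y)
  have hq := opNormR_nonneg (Y * Z)
  have hl : 0 < opNormR Y := hμ.trans_le hμY
  have hσ : √μ ^ 2 = μ := Real.sq_sqrt hμ.le
  have hσ0 := Real.sqrt_nonneg μ
  generalize opNormR X = x at *
  generalize opNormR Z = z at *
  generalize opNormR (X * Y) = p at *
  generalize opNormR (Y * Z) = q at *
  generalize opNormR (X * (Y * Z)) = m at *
  generalize opNormR Y = l at *
  have hμl : μ ^ 2 ≤ l ^ 2 := pow_le_pow_left₀ hμ.le hμY 2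
  have hxz : x * z ≤ (μ * r)⁻¹ * (p * q) := by
    have h3 := mul_le_mul hXY hYZ (by positivity) (by positivity)
    have h4 : r * (x * z) * l ^ 2 ≤ p * q * μ := by
      calc r * (x * z) * l ^ 2 = x * l * (r * (l * z)) := by ring
        _ ≤ _ := h3
        _ = p * q * √μ ^ 2 := by ring
        _ = _ := by rw [hσ]
    have h5 : r * (x * z) * μ ^ 2 ≤ p * q * μ :=
      (mul_le_mul_of_nonneg_left hμl (by positivity)).trans h4
    rw [inv_mul_eq_div, le_div_iff₀ (by positivity)]
    nlinarith
  have hμl4 : μ ^ 4 ≤ l ^ 4 := pow_le_pow_left₀ hμ.le hμY 4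
  have hX2 : (x * l⁻¹) ^ 2 ≤ (μ * r)⁻¹ ^ 2 / μ * p ^ 2 := by
    have h3 : (x * l) ^ 2 ≤ p ^ 2 * μ := by
      rw [← hσ, ← mul_pow]; exact pow_le_pow_left₀ (by positivity) hXY 2
    have e1 : (x * l⁻¹) ^ 2 = (x * l) ^ 2 / l ^ 4 := by field_simp
    have e2 : (μ * r)⁻¹ ^ 2 / μ * p ^ 2 = (p ^ 2 * μ / r ^ 2) / μ ^ 4 := by field_simp
    rw [e1, e2]
    have h4 : p ^ 2 * μ ≤ p ^ 2 * μ / r ^ 2 :=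
      le_div_self (by positivity) (by positivity) (pow_le_one₀ hr.le hr1)
    exact div_le_div₀ (by positivity) (h3.trans h4) (by positivity) hμl4
  have hZ2 : (z * l⁻¹) ^ 2 ≤ (μ * r)⁻¹ ^ 2 / μ * q ^ 2 := by
    have h3 : (r * (l * z)) ^ 2 ≤ q ^ 2 * μ := by
      rw [← hσ, ← mul_pow]; exact pow_le_pow_left₀ (by positivity) hYZ 2
    have e1 : (z * l⁻¹) ^ 2 = ((r * (l * z)) ^ 2 / r ^ 2) / l ^ 4 := by field_simp
    have e2 : (μ * r)⁻¹ ^ 2 / μ * q ^ 2 = (q ^ 2 * μ / r ^ 2) / μ ^ 4 := by field_simp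
    rw [e1, e2]
    gcongr
  have hε : (μ * r)⁻¹ ^ 2 / μ ≤ 1 := by
    have h3 : (μ * r)⁻¹ ^ 2 ≤ 1 := pow_le_one₀ (by positivity) (inv_le_one_of_one_le₀ hμr)
    have h4 : 1 ≤ μ := hμr.trans (mul_le_of_le_one_right hμ.le hr1)
    exact div_le_one_of_le₀ (h3.trans h4) hμ.le
  have h3 := h2 hε hX2 hZ2
  constructor <;> linarith

lemma mul_le_mul_sqrt_of_abs_log_lt {a b p μ : ℝ} (ha : 0 < a) (hb : 0 < b) (hp : 0 < p)
    (hμ : 0 < μ) (h : |Real.log a + Real.log b - Real.log p| < (1 / 2) * Real.log μ) :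
    b * a ≤ p * √μ := by
  have h1 := (abs_lt.1 h).2
  have h2 : Real.log (b * a) < Real.log (p * √μ) := by
    rw [Real.log_mul hb.ne' ha.ne', Real.log_mul hp.ne' (Real.sqrt_pos.2 hμ).ne',
      Real.log_sqrt hμ.le]
    linarith
  exact ((Real.log_lt_log_iff (by positivity) (by positivity)).1 h2).le

lemma abs_log_le_of_bounds {R μ r : ℝ} (hμ : 3 ≤ μ) (hr : 1 / 2 ≤ r) (hμr : 5 / 2 ≤ μ * r)
    (hl : 1 - (μ * r)⁻¹ ^ 2 / μ - (μ * r)⁻¹ ≤ R) (hu : R ≤ 1 + (μ * r)⁻¹) :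
    1 / 2 ≤ R ∧ |Real.log R| ≤ 6 / μ := by
  have hs : (μ * r)⁻¹ ≤ 2 / 5 := by
    rw [inv_le_comm₀ (by linarith) (by norm_num)]; linarith
  have hs0 : 0 < (μ * r)⁻¹ := by positivity
  have hsμ : (μ * r)⁻¹ ≤ 2 / μ := by
    rw [inv_le_comm₀ (by positivity) (by positivity), inv_div]; nlinarith
  have h6 : 6 / μ = 3 * (2 / μ) := by ring
  generalize (μ * r)⁻¹ = s at *
  have hsq : s ^ 2 / μ ≤ 2 / 15 * s := by
    rw [div_le_iff₀ (by linarith)]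
    nlinarith
  have hR : 1 / 2 ≤ R := by linarith
  have hR0 : 0 < R := by linarith
  refine ⟨hR, abs_le.2 ⟨?_, ?_⟩⟩
  · have h1 := Real.one_sub_inv_le_log_of_pos hR0
    have h2 : -(3 * s) ≤ 1 - R⁻¹ := by
      have : R⁻¹ ≤ 1 + 3 * s := by
        rw [inv_le_comm₀ hR0 (by positivity), inv_le_iff_one_le_mul₀ (by positivity)]
        nlinarith
      linarith
    linarith
  · have := Real.log_le_sub_one_of_pos hR0
    linarith

/-- The product `A (k - 1) * ⋯ * A 0`. -/
noncomputable def matrixChain (A : ℕ → Matrix (Fin 2) (Fin 2) ℝ) (k : ℕ) :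
    Matrix (Fin 2) (Fin 2) ℝ := (List.ofFn fun i : Fin k => A i).reverse.prod

/-- The multiplicative error in approximating the growth `‖matrixChain A (k + 3)‖ /
‖matrixChain A (k + 2)‖` by `‖A (k + 2) * A (k + 1)‖ / ‖A (k + 1)‖`. -/
noncomputable def chainRatio (A : ℕ → Matrix (Fin 2) (Fin 2) ℝ) (k : ℕ) : ℝ :=
  opNormR (A (k + 1)) * opNormR (matrixChain A (k + 3)) /
    (opNormR (A (k + 2) * A (k + 1)) * opNormR (matrixChain A (k + 2)))

lemma matrixChain_succ (A : ℕ → Matrix (Fin 2) (Fin 2) ℝ) (k : ℕ) :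
    matrixChain A (k + 1) = A k * matrixChain A k := by
  rw [matrixChain, List.ofFn_succ', List.concat_eq_append, List.reverse_append]
  simp [matrixChain]

lemma matrixChain_one (A : ℕ → Matrix (Fin 2) (Fin 2) ℝ) : matrixChain A 1 = A 0 := by
  simp [matrixChain]

lemma matrixChain_two (A : ℕ → Matrix (Fin 2) (Fin 2) ℝ) : matrixChain A 2 = A 1 * A 0 := by
  simp [matrixChain]

lemma opNormR_matrixChain_pos {A : ℕ → Matrix (Fin 2) (Fin 2) ℝ} {k : ℕ}
    (hA : ∀ j < k, (A j).det = 1) : 0 < opNormR (matrixChain A k) := by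
  refine opNormR_pos ?_
  induction k with
  | zero => simp [matrixChain]
  | succ k ih =>
    rw [matrixChain_succ, Matrix.det_mul, hA k k.lt_succ_self,
      ih fun j hj => hA j (hj.trans k.lt_succ_self), one_mul]

lemma opNormR_mul_pos {A B : Matrix (Fin 2) (Fin 2) ℝ} (hA : A.det = 1) (hB : B.det = 1) :
    0 < opNormR (A * B) :=
  opNormR_pos (by rw [Matrix.det_mul, hA, hB, one_mul])

lemma chainRatio_bounds {A : ℕ → Matrix (Fin 2) (Fin 2) ℝ} {k : ℕ} {μ r : ℝ}
    (hdet : ∀ j < k + 3, (A j).det = 1) (hμ : 0 < μ) (hnorm : μ ≤ opNormR (A (k + 1)))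
    (hpair : opNormR (A (k + 2)) * opNormR (A (k + 1)) ≤ opNormR (A (k + 2) * A (k + 1)) * √μ)
    (hr : 0 < r) (hr1 : r ≤ 1) (hμr : 1 ≤ μ * r)
    (h : r * (opNormR (A (k + 1)) * opNormR (matrixChain A (k + 1))) ≤
      opNormR (matrixChain A (k + 2)) * √μ) :
    1 - (μ * r)⁻¹ ^ 2 / μ - (μ * r)⁻¹ ≤ chainRatio A k ∧ chainRatio A k ≤ 1 + (μ * r)⁻¹ := by
  have hden := mul_pos (opNormR_mul_pos (hdet (k + 2) (by omega)) (hdet (k + 1) (by omega)))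
    (opNormR_matrixChain_pos (k := k + 2) fun j hj => hdet j (by omega))
  rw [matrixChain_succ A (k + 1)] at h hden
  rw [chainRatio, matrixChain_succ A (k + 2), matrixChain_succ A (k + 1), le_div_iff₀ hden,
    div_le_iff₀ hden]
  exact opNormR_triple_bounds (hdet (k + 1) (by omega)) hμ hr hr1 hμr hnorm hpair h

lemma mul_opNormR_le_of_le_chainRatio {A : ℕ → Matrix (Fin 2) (Fin 2) ℝ} {k : ℕ} {μ r : ℝ}
    (hdet : ∀ j < k + 3, (A j).det = 1)
    (hpair : opNormR (A (k + 2)) * opNormR (A (k + 1)) ≤ opNormR (A (k + 2) * A (k + 1)) * √μ)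
    (hr : r ≤ chainRatio A k) :
    r * (opNormR (A (k + 2)) * opNormR (matrixChain A (k + 2))) ≤
      opNormR (matrixChain A (k + 3)) * √μ := by
  have ha := opNormR_pos (hdet (k + 1) (by omega))
  have hc := opNormR_pos (hdet (k + 2) (by omega))
  have hp := opNormR_mul_pos (hdet (k + 2) (by omega)) (hdet (k + 1) (by omega))
  have hb := opNormR_matrixChain_pos (k := k + 2) fun j hj => hdet j (by omega)
  have hd := opNormR_matrixChain_pos hdet
  unfold chainRatio at hr
  generalize opNormR (A (k + 1)) = a at *
  generalize opNormR (A (k + 2)) = c at *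
  generalize opNormR (A (k + 2) * A (k + 1)) = p at *
  generalize opNormR (matrixChain A (k + 2)) = b at *
  generalize opNormR (matrixChain A (k + 3)) = d at *
  calc r * (c * b) ≤ a * d / (p * b) * (c * b) := by gcongr
    _ = d / p * (c * a) := by field_simp
    _ ≤ d / p * (p * √μ) := by gcongr
    _ = d * √μ := by field_simp

lemma log_chainRatio {A : ℕ → Matrix (Fin 2) (Fin 2) ℝ} {k : ℕ}
    (hdet : ∀ j < k + 3, (A j).det = 1) :
    Real.log (chainRatio A k) =
      Real.log (opNormR (A (k + 1))) + Real.log (opNormR (matrixChain A (k + 3))) -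
        (Real.log (opNormR (A (k + 2) * A (k + 1))) +
          Real.log (opNormR (matrixChain A (k + 2)))) := by
  have ha := (opNormR_pos (hdet (k + 1) (by omega))).ne'
  have hp := (opNormR_mul_pos (hdet (k + 2) (by omega)) (hdet (k + 1) (by omega))).ne'
  have hb := (opNormR_matrixChain_pos (k := k + 2) fun j hj => hdet j (by omega)).ne'
  have hd := (opNormR_matrixChain_pos hdet).ne'
  rw [chainRatio, Real.log_div (mul_ne_zero ha hd) (mul_ne_zero hp hb), Real.log_mul ha hd,
    Real.log_mul hp hb]

lemma abs_log_chainRatio_le {A : ℕ → Matrix (Fin 2) (Fin 2) ℝ} {n k : ℕ} {μ : ℝ}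
    (hnμ : (n : ℝ) < μ) (hdet : ∀ j < n, (A j).det = 1) (hnorm : ∀ j < n, μ ≤ opNormR (A j))
    (hpair : ∀ j, j + 1 < n →
      opNormR (A (j + 1)) * opNormR (A j) ≤ opNormR (A (j + 1) * A j) * √μ)
    (hk : k + 2 < n) : 1 / 2 ≤ chainRatio A k ∧ |Real.log (chainRatio A k)| ≤ 6 / μ := by
  have hn3 : (3 : ℝ) ≤ n := by exact_mod_cast (by omega : 3 ≤ n)
  have hμ3 : 3 ≤ μ := by linarith
  have hstep : ∀ k, k + 2 < n → ∀ r, 1 / 2 ≤ r → r ≤ 1 → 5 / 2 ≤ μ * r →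
      r * (opNormR (A (k + 1)) * opNormR (matrixChain A (k + 1))) ≤
        opNormR (matrixChain A (k + 2)) * √μ →
      1 - (μ * r)⁻¹ ^ 2 / μ - (μ * r)⁻¹ ≤ chainRatio A k ∧ chainRatio A k ≤ 1 + (μ * r)⁻¹ :=
    fun k hk r hr hr1 hμr h => chainRatio_bounds (fun j hj => hdet j (by omega)) (by linarith)
      (hnorm _ (by omega)) (hpair (k + 1) hk) (by linarith) hr1 (by linarith) h
  have hnext : ∀ k, k + 2 < n → ∀ r ≤ chainRatio A k, _ := fun k hk r hr =>
    mul_opNormR_le_of_le_chainRatio (fun j hj => hdet j (by omega)) (hpair (k + 1) hk) hr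
  have hzero := hstep 0 (by omega) 1 (by norm_num) le_rfl (by linarith)
    (by simpa [matrixChain_one, matrixChain_two] using hpair 0 (by omega))
  induction k with
  | zero => exact abs_log_le_of_bounds hμ3 (by norm_num) (by linarith) hzero.1 hzero.2
  | succ k ih =>
    rcases (by omega : (k = 0 ∧ n = 4) ∨ 5 ≤ n) with ⟨rfl, h4⟩ | h5
    · have hμ4 : 4 ≤ μ := by
        rw [h4] at hnμ
        exact_mod_cast hnμ.le
      have h7 : 7 / 10 ≤ chainRatio A 0 := by
        have hs : (μ * 1)⁻¹ ≤ 1 / 4 := by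
          rw [inv_le_comm₀ (by linarith) (by norm_num)]; linarith
        have hs2 : (μ * 1)⁻¹ ^ 2 / μ ≤ (1 / 4) ^ 2 / 4 := by gcongr
        linarith [hzero.1]
      obtain ⟨h1, h2⟩ := hstep 1 hk (7 / 10) (by norm_num) (by norm_num) (by linarith)
        (hnext 0 (by omega) _ h7)
      exact abs_log_le_of_bounds hμ3 (by norm_num) (by linarith) h1 h2
    · have hn5 : (5 : ℝ) ≤ n := by exact_mod_cast h5
      obtain ⟨h1, h2⟩ := hstep (k + 1) hk (1 / 2) le_rfl (by norm_num) (by linarith)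
        (hnext k (by omega) _ (ih (by omega)).1)
      exact abs_log_le_of_bounds hμ3 le_rfl (by linarith) h1 h2

/-- Avalanche principle: there is an absolute constant `C` such that for any
matrices `A 0, …, A (n-1)` in `SL(2,ℝ)` with `min_j ‖A j‖ ≥ μ > n` and
`|log ‖A j‖ + log ‖A (j+1)‖ - log ‖A (j+1) * A j‖| < (1/2) log μ`, one has
`|log ‖A (n-1) ⋯ A 0‖ + ∑_{j=1}^{n-2} log ‖A j‖
  - ∑_{j=0}^{n-2} log ‖A (j+1) * A j‖| < C * n / μ`. -/
theorem avalanche_principle :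
    ∃ C : ℝ, 0 < C ∧ ∀ (n : ℕ) (μ : ℝ) (A : ℕ → Matrix (Fin 2) (Fin 2) ℝ),
      1 < n → (n : ℝ) < μ →
      (∀ j < n, (A j).det = 1) →
      (∀ j < n, μ ≤ opNormR (A j)) →
      (∀ j : ℕ, j + 1 < n →
        |Real.log (opNormR (A j)) + Real.log (opNormR (A (j + 1))) -
          Real.log (opNormR (A (j + 1) * A j))| < (1 / 2) * Real.log μ) →
      |Real.log (opNormR ((List.ofFn fun i : Fin n => A i).reverse.prod)) +
          (∑ j ∈ Finset.Ico 1 (n - 1), Real.log (opNormR (A j))) -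
          ∑ j ∈ Finset.range (n - 1), Real.log (opNormR (A (j + 1) * A j))|
        < C * n / μ := by
  refine ⟨6, by norm_num, fun n μ A hn hnμ hdet hnorm hlog => ?_⟩
  have hn2 : (2 : ℝ) ≤ n := by exact_mod_cast hn
  have hμ0 : 0 < μ := by linarith
  have hpair : ∀ j, j + 1 < n →
      opNormR (A (j + 1)) * opNormR (A j) ≤ opNormR (A (j + 1) * A j) * √μ := fun j hj =>
    mul_le_mul_sqrt_of_abs_log_lt (opNormR_pos (hdet j (by omega))) (opNormR_pos (hdet _ hj))
      (opNormR_mul_pos (hdet _ hj) (hdet j (by omega))) hμ0 (hlog j hj)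
  have hsum : ∀ k, k + 2 ≤ n →
      |Real.log (opNormR (matrixChain A (k + 2))) +
          (∑ j ∈ Finset.Ico 1 (k + 1), Real.log (opNormR (A j))) -
        ∑ j ∈ Finset.range (k + 1), Real.log (opNormR (A (j + 1) * A j))| ≤ k * (6 / μ) := by
    intro k hk
    induction k with
    | zero => simp [matrixChain_two]
    | succ k ih =>
      have h1 := (abs_log_chainRatio_le hnμ hdet hnorm hpair hk).2
      have h2 := abs_add_le _ _ |>.trans (add_le_add (ih (by omega)) h1)
      rw [Finset.sum_Ico_succ_top (by omega), Finset.sum_range_succ _ (k + 1)]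
      refine le_trans (le_of_eq ?_) (h2.trans_eq (by push_cast; ring))
      rw [log_chainRatio fun j hj => hdet j (by omega)]
      congr 1
      ring
  obtain ⟨k, rfl⟩ := Nat.exists_eq_add_of_le' (show 2 ≤ n from hn)
  refine (hsum k le_rfl).trans_lt ?_
  rw [mul_div_assoc', div_lt_div_iff_of_pos_right hμ0]
  push_cast
  linarith
end

section
/- Let A : 𝕋 → SL(2,ℝ) be continuous with sup‖A‖ ≤ e^{C₁}, let p/q ∈ ℚ in lowest terms, and write n = mq + r with m ∈ ℕ, 0 ≤ r < q. Then the finite Lyapunov exponent L_n(p/q, A) = (1/n)∫_𝕋 ln‖A_n(θ)‖dθ satisfies L_n(p/q, A) ≤ L(p/q, A) + (2/n)·(ln m + q·C₁), where A_n(θ) = A(θ+(n−1)p/q)⋯A(θ) and L = inf_n L_n. -/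
/-- The `n`-step transfer matrix of the cocycle `(β, A)`:
`transfer A β n θ = A (θ + (n-1)β) ⋯ A (θ + β) * A θ`. -/
noncomputable def transfer (A : ℝ → Matrix (Fin 2) (Fin 2) ℝ) (β : ℝ) :
    ℕ → ℝ → Matrix (Fin 2) (Fin 2) ℝ
  | 0, _ => 1
  | n + 1, θ => A (θ + n * β) * transfer A β n θ

open scoped Matrix.Norms.L2Operator

namespace Matrix

theorem one_le_norm_of_det_eq_one {M : Matrix (Fin 2) (Fin 2) ℝ} (hM : M.det = 1) :
    1 ≤ ‖M‖ := by
  by_contra! h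
  have hdet : Filter.Tendsto (fun k : ℕ => (M ^ k).det) Filter.atTop
      (nhds (0 : Matrix (Fin 2) (Fin 2) ℝ).det) :=
    (continuous_id.matrix_det.tendsto _).comp (tendsto_pow_atTop_nhds_zero_of_norm_lt_one h)
  simp only [det_pow, hM, one_pow] at hdet
  simpa using tendsto_nhds_unique hdet tendsto_const_nhds

theorem abs_pow_le_norm_pow_of_isRoot {M : Matrix (Fin 2) (Fin 2) ℝ} {l : ℝ}
    (hM : M.det = 1) (hl : l * l - M.trace * l + 1 = 0) (k : ℕ) : |l| ^ k ≤ ‖M ^ k‖ := by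
  have hdet : (M - l • (1 : Matrix (Fin 2) (Fin 2) ℝ)).det = 0 := by
    rw [det_fin_two] at hM ⊢
    rw [trace_fin_two] at hl
    simp
    linarith
  obtain ⟨v, hv, hMv⟩ := exists_mulVec_eq_zero_iff.mpr hdet
  have hMv' : M *ᵥ v = l • v := by
    rwa [sub_mulVec, smul_mulVec, one_mulVec, sub_eq_zero] at hMv
  have hpow : M ^ k *ᵥ v = l ^ k • v := by
    induction k with
    | zero => simp
    | succ k ih => rw [pow_succ, ← mulVec_mulVec, hMv', mulVec_smul, ih, smul_smul, pow_succ']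
  have hle := l2_opNorm_mulVec (M ^ k) (WithLp.toLp 2 v)
  have hv' : 0 < ‖WithLp.toLp 2 v‖ := by simpa using hv
  have heq : (WithLp.toLp 2 (M ^ k *ᵥ v) : EuclideanSpace ℝ (Fin 2)) =
      l ^ k • WithLp.toLp 2 v := by rw [hpow]; rfl
  change ‖(WithLp.toLp 2 (M ^ k *ᵥ v) : EuclideanSpace ℝ (Fin 2))‖ ≤ _ at hle
  rw [heq, norm_smul, norm_pow, Real.norm_eq_abs] at hle
  exact le_of_mul_le_mul_right hle hv'

end Matrix

/-- The spectral radius of a matrix in `SL(2,ℝ)` of trace `t`. -/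
noncomputable def traceRadius (t : ℝ) : ℝ :=
  (max |t| 2 + √((max |t| 2) ^ 2 - 4)) / 2

theorem continuous_traceRadius : Continuous traceRadius := by
  unfold traceRadius
  fun_prop

theorem one_le_traceRadius (t : ℝ) : 1 ≤ traceRadius t := by
  have h1 := le_max_right |t| 2
  have h2 := Real.sqrt_nonneg ((max |t| 2) ^ 2 - 4)
  unfold traceRadius
  linarith

theorem traceRadius_of_abs_le {t : ℝ} (ht : |t| ≤ 2) : traceRadius t = 1 := by
  rw [traceRadius, max_eq_right ht]
  norm_num

theorem traceRadius_root {t : ℝ} (ht : 2 ≤ |t|) :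
    traceRadius t * traceRadius t - |t| * traceRadius t + 1 = 0 := by
  have hs := Real.mul_self_sqrt (show 0 ≤ |t| ^ 2 - 4 by nlinarith)
  rw [traceRadius, max_eq_left ht]
  linarith

theorem exists_real_root {t : ℝ} (ht : 2 ≤ |t|) :
    ∃ l : ℝ, |l| = traceRadius t ∧ l * l - t * l + 1 = 0 := by
  have h1 := one_le_traceRadius t
  have h2 := traceRadius_root ht
  rcases le_total 0 t with h | h
  · exact ⟨traceRadius t, abs_of_nonneg (by linarith), by rwa [abs_of_nonneg h] at h2⟩
  · refine ⟨-traceRadius t, ?_, ?_⟩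
    · rw [abs_neg, abs_of_nonneg (by linarith)]
    · rw [abs_of_nonpos h] at h2
      linarith

theorem exists_complex_roots (t : ℝ) :
    ∃ l u : ℂ, l + u = t ∧ l * u = 1 ∧ ‖l‖ ≤ traceRadius t ∧ ‖u‖ ≤ traceRadius t := by
  rcases le_total |t| 2 with ht | ht
  · have hs := Real.mul_self_sqrt
      (show 0 ≤ 4 - t ^ 2 by nlinarith [abs_mul_abs_self t, abs_nonneg t])
    have hnorm : ∀ z : ℂ, Complex.normSq z = 1 → ‖z‖ ≤ traceRadius t := fun z hz => by
      rw [traceRadius_of_abs_le ht, Complex.norm_def, hz, Real.sqrt_one]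
    refine ⟨⟨t / 2, √(4 - t ^ 2) / 2⟩, ⟨t / 2, -(√(4 - t ^ 2) / 2)⟩, ?_, ?_,
      hnorm _ ?_, hnorm _ ?_⟩
    · apply Complex.ext <;> simp
    · apply Complex.ext <;> simp <;> linarith
    · rw [Complex.normSq_mk]; linarith
    · rw [Complex.normSq_mk]; linarith
  · obtain ⟨l, hl, hroot⟩ := exists_real_root ht
    have h1 := one_le_traceRadius t
    have hl0 : l ≠ 0 := by rintro rfl; simp at hroot
    have hroot' : (l : ℂ) * l - t * l + 1 = 0 := mod_cast hroot
    have hmul : (l : ℂ) * (t - l) = 1 := by linear_combination -hroot'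
    refine ⟨l, t - l, by ring, hmul, ?_, ?_⟩
    · rw [Complex.norm_real, Real.norm_eq_abs, hl]
    · have := congrArg norm hmul
      rw [norm_mul, Complex.norm_real, Real.norm_eq_abs, hl, norm_one] at this
      nlinarith [norm_nonneg ((t : ℂ) - l)]

/-- The Chebyshev-type sequence with `a 0 = 0`, `a 1 = 1`, `a (k + 2) = t * a (k + 1) - a k`. -/
def chebSeq (t : ℝ) : ℕ → ℝ
  | 0 => 0
  | 1 => 1
  | k + 2 => t * chebSeq t (k + 1) - chebSeq t k

theorem abs_chebSeq_succ_le (t : ℝ) (k : ℕ) :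
    |chebSeq t (k + 1)| ≤ (k + 1) * traceRadius t ^ k := by
  obtain ⟨l, u, hadd, hmul, hl, hu⟩ := exists_complex_roots t
  have hrec : ∀ k : ℕ, (chebSeq t (k + 1) : ℂ) = l * chebSeq t k + u ^ k := by
    intro k
    induction k with
    | zero => simp [chebSeq]
    | succ k ih =>
      rw [chebSeq]
      push_cast
      rw [← hadd, pow_succ]
      linear_combination u * ih + (chebSeq t k : ℂ) * hmul
  induction k with
  | zero => simp [chebSeq]
  | succ k ih =>
    have h0 : 0 ≤ traceRadius t := zero_le_one.trans (one_le_traceRadius t)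
    calc |chebSeq t (k + 1 + 1)| = ‖(chebSeq t (k + 1 + 1) : ℂ)‖ := by simp
      _ ≤ ‖l‖ * |chebSeq t (k + 1)| + ‖u‖ ^ (k + 1) := by
        rw [hrec]
        exact (norm_add_le _ _).trans (by simp)
      _ ≤ traceRadius t * ((k + 1) * traceRadius t ^ k) + traceRadius t ^ (k + 1) := by
        gcongr
      _ = ((k + 1 : ℕ) + 1) * traceRadius t ^ (k + 1) := by push_cast; ring

theorem abs_chebSeq_le (t : ℝ) (k : ℕ) : |chebSeq t k| ≤ k * traceRadius t ^ k := by
  cases k with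
  | zero => simp [chebSeq]
  | succ k =>
    refine (abs_chebSeq_succ_le t k).trans ?_
    push_cast
    gcongr
    · exact one_le_traceRadius t
    · exact Nat.le_succ k

namespace Matrix

theorem pow_succ_eq_chebSeq {M : Matrix (Fin 2) (Fin 2) ℝ} (hM : M.det = 1) (k : ℕ) :
    M ^ (k + 1) = chebSeq M.trace (k + 1) • M - chebSeq M.trace k • 1 := by
  have hsq : M * M = M.trace • M - 1 := by
    rw [det_fin_two] at hM
    ext i j
    fin_cases i <;> fin_cases j <;> simp [mul_apply, trace_fin_two] <;> linarith
  induction k with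
  | zero => simp [chebSeq]
  | succ k ih =>
    rw [pow_succ, ih, sub_mul, smul_mul_assoc, smul_mul_assoc, hsq, one_mul, chebSeq]
    module

theorem norm_pow_le_traceRadius {M : Matrix (Fin 2) (Fin 2) ℝ} (hM : M.det = 1)
    {m : ℕ} (hm : 1 ≤ m) : ‖M ^ m‖ ≤ (m : ℝ) ^ 2 * ‖M‖ * traceRadius M.trace ^ m := by
  obtain ⟨k, rfl⟩ := Nat.exists_eq_add_of_le' hm
  have hR := one_le_traceRadius M.trace
  have hnorm := one_le_norm_of_det_eq_one hM
  have hpow : traceRadius M.trace ^ k ≤ traceRadius M.trace ^ (k + 1) :=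
    pow_le_pow_right₀ hR k.le_succ
  have hp : 0 ≤ traceRadius M.trace ^ (k + 1) := by positivity
  rw [pow_succ_eq_chebSeq hM]
  calc _ ≤ |chebSeq M.trace (k + 1)| * ‖M‖ + |chebSeq M.trace k| := by
        refine (norm_sub_le _ _).trans ?_
        rw [norm_smul, norm_smul, norm_one, Real.norm_eq_abs, Real.norm_eq_abs, mul_one]
    _ ≤ ((k + 1 : ℕ) * traceRadius M.trace ^ (k + 1)) * ‖M‖
          + k * traceRadius M.trace ^ (k + 1) := by
        gcongr
        · exact abs_chebSeq_le _ _
        · exact (abs_chebSeq_le _ _).trans (by gcongr)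
    _ ≤ _ := by
        have hk : (0 : ℝ) ≤ k := k.cast_nonneg
        have h : ((k + 1 : ℕ) : ℝ) * ‖M‖ + k ≤ ((k + 1 : ℕ) : ℝ) ^ 2 * ‖M‖ := by
          push_cast
          nlinarith [mul_nonneg hk (sub_nonneg.mpr hnorm), mul_nonneg (mul_nonneg hk hk)
            (norm_nonneg M)]
        nlinarith [mul_le_mul_of_nonneg_right h hp]

theorem traceRadius_pow_le_norm_pow {M : Matrix (Fin 2) (Fin 2) ℝ} (hM : M.det = 1) (k : ℕ) :
    traceRadius M.trace ^ k ≤ ‖M ^ k‖ := by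
  rcases le_total |M.trace| 2 with ht | ht
  · rw [traceRadius_of_abs_le ht, one_pow]
    exact one_le_norm_of_det_eq_one (by rw [det_pow, hM, one_pow])
  · obtain ⟨l, hl, hroot⟩ := exists_real_root ht
    rw [← hl]
    exact abs_pow_le_norm_pow_of_isRoot hM hroot k

end Matrix

section Transfer

variable {A : ℝ → Matrix (Fin 2) (Fin 2) ℝ}

theorem transfer_add (β : ℝ) (k l : ℕ) (θ : ℝ) :
    transfer A β (k + l) θ = transfer A β k (θ + l * β) * transfer A β l θ := by
  induction k with
  | zero => simp [transfer]
  | succ k ih =>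
    rw [Nat.succ_add, transfer, transfer, ih, ← mul_assoc]
    congr 3
    push_cast
    ring

theorem periodic_transfer (hper : Function.Periodic A 1) (β : ℝ) (k : ℕ) :
    Function.Periodic (transfer A β k) 1 := by
  intro θ
  induction k with
  | zero => rfl
  | succ k ih => rw [transfer, transfer, ih, add_right_comm, hper]

theorem det_transfer (hdet : ∀ θ, (A θ).det = 1) (β : ℝ) (k : ℕ) (θ : ℝ) :
    (transfer A β k θ).det = 1 := by
  induction k with
  | zero => simp [transfer]
  | succ k ih => rw [transfer, Matrix.det_mul, hdet, ih, one_mul]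

theorem continuous_transfer (hcont : Continuous A) (β : ℝ) (k : ℕ) :
    Continuous (transfer A β k) := by
  induction k with
  | zero => exact continuous_const
  | succ k ih => exact (hcont.comp (by fun_prop)).mul ih

theorem norm_transfer_le {C : ℝ} (hC : ∀ θ, ‖A θ‖ ≤ Real.exp C) (β : ℝ) (k : ℕ) (θ : ℝ) :
    ‖transfer A β k θ‖ ≤ Real.exp (k * C) := by
  induction k with
  | zero => simp [transfer]
  | succ k ih =>
    rw [transfer]
    calc _ ≤ ‖A (θ + k * β)‖ * ‖transfer A β k θ‖ := norm_mul_le _ _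
      _ ≤ Real.exp C * Real.exp (k * C) := by gcongr; exact hC _
      _ = _ := by rw [← Real.exp_add]; push_cast; ring_nf

theorem transfer_mul_eq_pow (hper : Function.Periodic A 1) (p : ℕ) {q : ℕ} (hq : 0 < q)
    (m : ℕ) (θ : ℝ) :
    transfer A ((p : ℝ) / q) (m * q) θ = transfer A ((p : ℝ) / q) q θ ^ m := by
  induction m with
  | zero => simp [transfer]
  | succ m ih =>
    have hq' : (q : ℝ) ≠ 0 := by positivity
    have hshift : ((m * q : ℕ) : ℝ) * ((p : ℝ) / q) = (m * p : ℕ) * 1 := by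
      push_cast
      field_simp
    rw [Nat.succ_mul, add_comm, transfer_add, ih, hshift,
      (periodic_transfer hper _ q).nat_mul (m * p) θ, pow_succ']

theorem continuous_log_norm_transfer (hcont : Continuous A) (hdet : ∀ θ, (A θ).det = 1)
    (β : ℝ) (k : ℕ) : Continuous fun θ => Real.log ‖transfer A β k θ‖ :=
  (continuous_transfer hcont β k).norm.log fun θ =>
    (one_pos.trans_le (Matrix.one_le_norm_of_det_eq_one (det_transfer hdet β k θ))).ne'

/-- The integral over one period of the logarithm of the norm of the transfer matrix. -/
noncomputable def logIntegral (A : ℝ → Matrix (Fin 2) (Fin 2) ℝ) (β : ℝ) (k : ℕ) : ℝ :=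
  ∫ θ in (0 : ℝ)..1, Real.log ‖transfer A β k θ‖

theorem logIntegral_nonneg (hdet : ∀ θ, (A θ).det = 1) (β : ℝ) (k : ℕ) :
    0 ≤ logIntegral A β k :=
  intervalIntegral.integral_nonneg zero_le_one fun θ _ =>
    Real.log_nonneg (Matrix.one_le_norm_of_det_eq_one (det_transfer hdet β k θ))

theorem logIntegral_add_le (hcont : Continuous A) (hper : Function.Periodic A 1)
    (hdet : ∀ θ, (A θ).det = 1) (β : ℝ) (k l : ℕ) :
    logIntegral A β (k + l) ≤ logIntegral A β k + logIntegral A β l := by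
  have hc := continuous_log_norm_transfer hcont hdet β
  have hpos : ∀ k θ, 0 < ‖transfer A β k θ‖ := fun k θ =>
    one_pos.trans_le (Matrix.one_le_norm_of_det_eq_one (det_transfer hdet β k θ))
  have hck : Continuous fun θ => Real.log ‖transfer A β k (θ + l * β)‖ :=
    (hc k).comp (by fun_prop)
  have hshift : ∫ θ in (0 : ℝ)..1, Real.log ‖transfer A β k (θ + l * β)‖ =
      logIntegral A β k := by
    have hp : Function.Periodic (fun θ => Real.log ‖transfer A β k θ‖) 1 :=
      (periodic_transfer hper β k).comp fun M => Real.log ‖M‖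
    rw [intervalIntegral.integral_comp_add_right fun θ => Real.log ‖transfer A β k θ‖,
      add_comm 1, zero_add, hp.intervalIntegral_add_eq _ 0, zero_add, logIntegral]
  rw [← hshift, logIntegral, logIntegral, ← intervalIntegral.integral_add
    (hck.intervalIntegrable _ _) ((hc l).intervalIntegrable _ _)]
  refine intervalIntegral.integral_mono zero_le_one ((hc _).intervalIntegrable _ _)
    ((hck.add (hc l)).intervalIntegrable _ _) fun θ => ?_
  change Real.log ‖transfer A β (k + l) θ‖ ≤
    Real.log ‖transfer A β k (θ + l * β)‖ + Real.log ‖transfer A β l θ‖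
  rw [← Real.log_mul (hpos _ _).ne' (hpos _ _).ne', transfer_add]
  refine Real.log_le_log ?_ (norm_mul_le _ _)
  rw [← transfer_add]
  exact hpos _ _

theorem logIntegral_mul_le (hcont : Continuous A) (hper : Function.Periodic A 1)
    (hdet : ∀ θ, (A θ).det = 1) (β : ℝ) (j k : ℕ) :
    logIntegral A β (j * k) ≤ j * logIntegral A β k := by
  induction j with
  | zero => simp [logIntegral, transfer]
  | succ j ih =>
    rw [Nat.succ_mul]
    have := logIntegral_add_le hcont hper hdet β (j * k) k
    push_cast
    linarith

theorem logIntegral_le (hcont : Continuous A) (hdet : ∀ θ, (A θ).det = 1) {C : ℝ}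
    (hC : ∀ θ, ‖A θ‖ ≤ Real.exp C) (β : ℝ) (k : ℕ) : logIntegral A β k ≤ k * C := by
  have h := intervalIntegral.integral_mono (μ := MeasureTheory.volume) (zero_le_one' ℝ)
    ((continuous_log_norm_transfer hcont hdet β k).intervalIntegrable 0 1)
    (continuous_const.intervalIntegrable (0 : ℝ) 1) (g := fun _ => k * C) fun θ =>
      (Real.log_le_iff_le_exp (one_pos.trans_le
        (Matrix.one_le_norm_of_det_eq_one (det_transfer hdet β k θ)))).mpr
        (norm_transfer_le hC β k θ)
  simpa [logIntegral] using h

/-- The integral over one period of the logarithm of the spectral radius of the transfer matrix. -/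
noncomputable def logRadiusIntegral (A : ℝ → Matrix (Fin 2) (Fin 2) ℝ) (β : ℝ) (k : ℕ) : ℝ :=
  ∫ θ in (0 : ℝ)..1, Real.log (traceRadius (transfer A β k θ).trace)

theorem continuous_log_traceRadius_transfer (hcont : Continuous A) (β : ℝ) (k : ℕ) :
    Continuous fun θ => Real.log (traceRadius (transfer A β k θ).trace) :=
  (continuous_traceRadius.comp (continuous_transfer hcont β k).matrix_trace).log fun _ =>
    (one_pos.trans_le (one_le_traceRadius _)).ne'

theorem mul_logRadiusIntegral_le (hcont : Continuous A) (hper : Function.Periodic A 1)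
    (hdet : ∀ θ, (A θ).det = 1) (p : ℕ) {q : ℕ} (hq : 0 < q) (k : ℕ) :
    k * logRadiusIntegral A ((p : ℝ) / q) q ≤ logIntegral A ((p : ℝ) / q) (k * q) := by
  rw [logRadiusIntegral, logIntegral, ← intervalIntegral.integral_const_mul]
  refine intervalIntegral.integral_mono zero_le_one
    ((continuous_const.mul (continuous_log_traceRadius_transfer hcont _ q)).intervalIntegrable _ _)
    ((continuous_log_norm_transfer hcont hdet _ _).intervalIntegrable _ _) fun θ => ?_
  have hR := one_le_traceRadius (transfer A ((p : ℝ) / q) q θ).trace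
  change k * Real.log (traceRadius (transfer A ((p : ℝ) / q) q θ).trace) ≤ Real.log _
  rw [← Real.log_pow, transfer_mul_eq_pow hper p hq]
  exact Real.log_le_log (by positivity)
    (Matrix.traceRadius_pow_le_norm_pow (det_transfer hdet _ _ _) k)

theorem logIntegral_mul_le_logRadiusIntegral (hcont : Continuous A)
    (hper : Function.Periodic A 1) (hdet : ∀ θ, (A θ).det = 1) {C : ℝ}
    (hC : ∀ θ, ‖A θ‖ ≤ Real.exp C) (p : ℕ) {q : ℕ} (hq : 0 < q) {m : ℕ} (hm : 1 ≤ m) :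
    logIntegral A ((p : ℝ) / q) (m * q) ≤
      2 * Real.log m + q * C + m * logRadiusIntegral A ((p : ℝ) / q) q := by
  have hcR := continuous_log_traceRadius_transfer hcont ((p : ℝ) / q) q
  have hint : ∫ θ in (0 : ℝ)..1, ((2 * Real.log m + q * C) +
      m * Real.log (traceRadius (transfer A ((p : ℝ) / q) q θ).trace)) =
      2 * Real.log m + q * C + m * logRadiusIntegral A ((p : ℝ) / q) q := by
    rw [intervalIntegral.integral_add (continuous_const.intervalIntegrable _ _)
      ((hcR.const_mul (m : ℝ)).intervalIntegrable _ _), intervalIntegral.integral_const_mul,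
      logRadiusIntegral]
    simp
  rw [← hint, logIntegral]
  refine intervalIntegral.integral_mono zero_le_one
    ((continuous_log_norm_transfer hcont hdet _ _).intervalIntegrable _ _)
    ((continuous_const.add (continuous_const.mul hcR)).intervalIntegrable _ _) fun θ => ?_
  set M := transfer A ((p : ℝ) / q) q θ with hMdef
  have hM : M.det = 1 := det_transfer hdet _ _ _
  have hM1 := Matrix.one_le_norm_of_det_eq_one hM
  have hR := one_le_traceRadius M.trace
  have hm0 : (0 : ℝ) < m := by exact_mod_cast hm
  have hlogM : Real.log ‖M‖ ≤ q * C :=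
    (Real.log_le_iff_le_exp (by linarith)).mpr (norm_transfer_le hC _ q θ)
  have hlog := Real.log_le_log (one_pos.trans_le (Matrix.one_le_norm_of_det_eq_one
    (show (M ^ m).det = 1 by rw [Matrix.det_pow, hM, one_pow])))
    (Matrix.norm_pow_le_traceRadius hM hm)
  rw [Real.log_mul (by positivity) (by positivity), Real.log_mul (by positivity) (by positivity),
    Real.log_pow, Real.log_pow] at hlog
  change Real.log ‖transfer A ((p : ℝ) / q) (m * q) θ‖ ≤
    2 * Real.log m + q * C + m * Real.log (traceRadius M.trace)
  rw [transfer_mul_eq_pow hper p hq, ← hMdef]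
  push_cast at hlog
  linarith

end Transfer

/-- For a continuous `1`-periodic `SL(2,ℝ)`-valued map `A` with
`‖A θ‖ ≤ e^{C₁}`, the finite Lyapunov exponents over the rotation by `p/q`
satisfy `L_n ≤ L + (2/n) * (log m + q C₁)` when `n = m q + r`, `0 ≤ r < q`,
where `L = inf_{n ≥ 1} L_n`. -/
theorem finite_LE_rational_bound (A : ℝ → Matrix (Fin 2) (Fin 2) ℝ)
    (hcont : Continuous A) (hper : ∀ θ : ℝ, A (θ + 1) = A θ)
    (hdet : ∀ θ : ℝ, (A θ).det = 1) (C₁ : ℝ)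
    (hC₁ : ∀ θ : ℝ, opNormR (A θ) ≤ Real.exp C₁)
    (p q : ℕ) (hq : 0 < q) (hcop : Nat.Coprime p q)
    (Ln : ℕ → ℝ)
    (hLn : ∀ n : ℕ, Ln n = (1 / (n : ℝ)) *
      ∫ θ in (0:ℝ)..1, Real.log (opNormR (transfer A ((p : ℝ) / q) n θ)))
    (Linf : ℝ) (hLinf : Linf = ⨅ m : ℕ, Ln (m + 1))
    (n m r : ℕ) (hm : 1 ≤ m) (hr : r < q) (hn : n = m * q + r) :
    Ln n ≤ Linf + (2 / (n : ℝ)) * (Real.log m + q * C₁) := by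
  have hC : ∀ θ, ‖A θ‖ ≤ Real.exp C₁ := hC₁
  have hLn' : ∀ k, Ln k = 1 / (k : ℝ) * logIntegral A ((p : ℝ) / q) k := hLn
  have hC0 : 0 ≤ C₁ := Real.one_le_exp_iff.mp
    ((Matrix.one_le_norm_of_det_eq_one (hdet 0)).trans (hC 0))
  have hq0 : (0 : ℝ) < q := by exact_mod_cast hq
  have hL0 : 0 ≤ Linf := by
    rw [hLinf]
    refine le_ciInf fun k => ?_
    rw [hLn']
    exact mul_nonneg (by positivity) (logIntegral_nonneg hdet _ _)
  have hRL : logRadiusIntegral A ((p : ℝ) / q) q ≤ q * Linf := by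
    rw [← div_le_iff₀' hq0, hLinf]
    refine le_ciInf fun k => ?_
    have h1 := mul_logRadiusIntegral_le hcont hper hdet p hq (k + 1)
    have h2 := logIntegral_mul_le hcont hper hdet ((p : ℝ) / q) q (k + 1)
    rw [mul_comm] at h2
    have hk : (0 : ℝ) < (k + 1 : ℕ) := by positivity
    rw [hLn', div_le_iff₀' hq0, one_div, mul_left_comm, ← div_eq_inv_mul, le_div_iff₀' hk]
    exact h1.trans h2
  have hn' : (n : ℝ) = m * q + r := by rw [hn]; push_cast; rfl
  have hm0 : (0 : ℝ) < m := by exact_mod_cast hm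
  have hn0 : (0 : ℝ) < n := by rw [hn']; positivity
  have hrC : r * C₁ ≤ q * C₁ := by gcongr
  have hI : logIntegral A ((p : ℝ) / q) n ≤ n * Linf + 2 * (Real.log m + q * C₁) := by
    have h1 := logIntegral_add_le hcont hper hdet ((p : ℝ) / q) (m * q) r
    have h2 := logIntegral_mul_le_logRadiusIntegral hcont hper hdet hC p hq hm
    have h3 := logIntegral_le hcont hdet hC ((p : ℝ) / q) r
    have h4 := mul_le_mul_of_nonneg_left hRL hm0.le
    have h5 : 0 ≤ r * Linf := by positivity
    rw [← hn] at h1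
    rw [hn']
    linarith
  rw [hLn', one_div, inv_mul_le_iff₀ hn0]
  calc _ ≤ _ := hI
    _ = _ := by field_simp
end
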